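/- Let n ∈ ℕ, s ∈ (0,1), A a Young function and φ an admissible function. Then V^{s,A}(ℝⁿ) → V𝓛^{φ}(ℝⁿ) uniformly if and only if there exists a constant c > 0 with φ_{s,A}(r) ≤ c φ(r) for all r > 0 and lim_{r→0⁺} φ_{s,A}(r)/φ(r) = 0. -/

import Mathlib

open MeasureTheory Metric Set Filter
open scoped ENNReal Topology

noncomputable section

/-- Euclidean space `ℝⁿ`. -/
abbrev Euc (n : ℕ) := EuclideanSpace ℝ (Fin n)

/-- A Young function: convex, left-continuous, vanishing at `0`,
non-constant on `(0,∞)`, with values in `[0,∞]`. -/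
def IsYoung (A : ℝ → ℝ≥0∞) : Prop :=
  A 0 = 0 ∧
  (∀ x y t : ℝ, 0 ≤ x → 0 ≤ y → 0 ≤ t → t ≤ 1 →
      A (t * x + (1 - t) * y) ≤ ENNReal.ofReal t * A x + ENNReal.ofReal (1 - t) * A y) ∧
  (∀ t : ℝ, 0 < t → ContinuousWithinAt A (Set.Iic t) t) ∧
  (∃ t₁ t₂ : ℝ, 0 < t₁ ∧ 0 < t₂ ∧ A t₁ ≠ A t₂)

/-- The right-continuous generalized inverse of a monotone function `A : [0,∞) → [0,∞]`. -/
def rcInv (A : ℝ → ℝ≥0∞) (v : ℝ≥0∞) : ℝ :=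
  sInf {τ : ℝ | 0 ≤ τ ∧ v < A τ}

/-- The Young conjugate `Ã(t) = sup {τ t - A(τ) : τ ≥ 0}`. -/
def youngConj (A : ℝ → ℝ≥0∞) (t : ℝ) : ℝ≥0∞ :=
  ⨆ (τ : ℝ) (_ : 0 ≤ τ), ENNReal.ofReal (τ * t) - A τ

/-- The functional `J_{σ,A}(v)` for a vector-valued `v`, with the Euclidean norm. -/
def Jfun (n : ℕ) (σ : ℝ) (A : ℝ → ℝ≥0∞) {ι : Type} [Fintype ι]
    (v : Euc n → ι → ℝ) : ℝ≥0∞ :=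
  ∫⁻ x : Euc n, ∫⁻ y : Euc n,
    A (Real.sqrt (∑ i, (v x i - v y i) ^ 2) / ‖x - y‖ ^ σ) /
      ENNReal.ofReal (‖x - y‖ ^ (n : ℝ))

/-- The fractional Orlicz–Sobolev seminorm `|v|_{σ,A,ℝⁿ}` (vector-valued version). -/
def fracSem (n : ℕ) (σ : ℝ) (A : ℝ → ℝ≥0∞) {ι : Type} [Fintype ι]
    (v : Euc n → ι → ℝ) : ℝ≥0∞ :=
  sInf (ENNReal.ofReal '' {lam : ℝ | 0 < lam ∧ Jfun n σ A (fun x i => v x i / lam) ≤ 1})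

/-- The fractional Orlicz–Sobolev seminorm `|u|_{σ,A,ℝⁿ}` of a scalar function. -/
def fracSemS (n : ℕ) (σ : ℝ) (A : ℝ → ℝ≥0∞) (u : Euc n → ℝ) : ℝ≥0∞ :=
  fracSem n σ A (fun x (_ : Fin 1) => u x)

/-- The normalized mean oscillation `φ(|B|^{1/n})⁻¹ ⨍_B |u - u_B|` over the ball `B = B(x,r)`. -/
def oscQuot (n : ℕ) (φ : ℝ → ℝ) (u : Euc n → ℝ) (x : Euc n) (r : ℝ) : ℝ :=
  (φ ((volume (ball x r)).toReal ^ ((n : ℝ)⁻¹)))⁻¹ *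
    ⨍ y in ball x r, |u y - ⨍ z in ball x r, u z|

/-- The Campanato seminorm `|u|_{𝓛^φ(ℝⁿ)}`. -/
def campSem (n : ℕ) (φ : ℝ → ℝ) (u : Euc n → ℝ) : ℝ≥0∞ :=
  ⨆ (x : Euc n) (r : ℝ) (_ : 0 < r), ENNReal.ofReal (oscQuot n φ u x r)

/-- The Campanato quantity restricted to balls of measure at most `r`. -/
def campSemSmall (n : ℕ) (φ : ℝ → ℝ) (u : Euc n → ℝ) (r : ℝ) : ℝ≥0∞ :=
  ⨆ (x : Euc n) (ρ : ℝ) (_ : 0 < ρ) (_ : volume (ball x ρ) ≤ ENNReal.ofReal r),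
    ENNReal.ofReal (oscQuot n φ u x ρ)

/-- `φ : (0,∞) → (0,∞)` is admissible: positive and bounded below away from zero on `[a,∞)`. -/
def Admissible (φ : ℝ → ℝ) : Prop :=
  (∀ r : ℝ, 0 < r → 0 < φ r) ∧
  ∀ a : ℝ, 0 < a → ∃ ε : ℝ, 0 < ε ∧ ∀ r : ℝ, a ≤ r → ε ≤ φ r

/-- `φ_{s,A}(r) = r^s A⁻¹(r^{-n})`. -/
def phiSA (n : ℕ) (s : ℝ) (A : ℝ → ℝ≥0∞) (r : ℝ) : ℝ :=
  r ^ s * rcInv A (ENNReal.ofReal (r ^ (-(n : ℝ))))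

/-- `u` is `m`-times weakly differentiable, with iterated weak partial
derivatives recorded by `D`. -/
def HasWeakDerivs (n m : ℕ) (u : Euc n → ℝ)
    (D : (h : ℕ) → Euc n → (Fin h → Fin n) → ℝ) : Prop :=
  (∀ x d, D 0 x d = u x) ∧
  ∀ h : ℕ, h ≤ m → ∀ dirs : Fin h → Fin n,
    LocallyIntegrable (fun x => D h x dirs) volume ∧
    ∀ φ : Euc n → ℝ, ContDiff ℝ (⊤ : ℕ∞) φ → HasCompactSupport φ →
      ∫ x : Euc n, u x *
          iteratedFDeriv ℝ h φ x (fun i => EuclideanSpace.single (dirs i) (1 : ℝ)) =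
        (-1 : ℝ) ^ h * ∫ x : Euc n, D h x dirs * φ x

/-- The Euclidean length `|∇^h u|(x)` of the `h`-th order weak gradient. -/
def gradLen (n : ℕ) (D : (h : ℕ) → Euc n → (Fin h → Fin n) → ℝ) (h : ℕ) (x : Euc n) : ℝ :=
  Real.sqrt (∑ d : Fin h → Fin n, (D h x d) ^ 2)

/-- The derivatives of orders `k, …, m` decay near infinity:
`|{|∇^h u| > t}| < ∞` for every `t > 0`. -/
def DecayFrom (n k m : ℕ) (D : (h : ℕ) → Euc n → (Fin h → Fin n) → ℝ) : Prop :=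
  ∀ h : ℕ, k ≤ h → h ≤ m → ∀ t : ℝ, 0 < t →
    volume {x : Euc n | t < gradLen n D h x} < ⊤

/-- The Young function `F_k(t) = t^{n/(n-s+k+1)} ∫_0^t Ã(τ) τ^{-1-n/(n-s+k+1)} dτ`. -/
def Fk (n : ℕ) (s : ℝ) (k : ℕ) (A : ℝ → ℝ≥0∞) (t : ℝ) : ℝ≥0∞ :=
  ENNReal.ofReal (t ^ ((n : ℝ) / ((n : ℝ) - s + (k : ℝ) + 1))) *
    ∫⁻ τ in Set.Ioc (0 : ℝ) t,
      youngConj A τ * ENNReal.ofReal (τ ^ (-1 - (n : ℝ) / ((n : ℝ) - s + (k : ℝ) + 1)))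

/-- `ψ^k_{s,A}(r) = 1 / (r^{n-s+k} F_k⁻¹(r^{-n}))`. -/
def psiK (n : ℕ) (s : ℝ) (k : ℕ) (A : ℝ → ℝ≥0∞) (r : ℝ) : ℝ :=
  (r ^ ((n : ℝ) - s + (k : ℝ)) * rcInv (Fk n s k A) (ENNReal.ofReal (r ^ (-(n : ℝ)))))⁻¹

/-- `ψ^{[s]}_{s,A}(r) = r^{{s}} A⁻¹(r^{-n})`. -/
def psiTop (n : ℕ) (s : ℝ) (A : ℝ → ℝ≥0∞) (r : ℝ) : ℝ :=
  r ^ (s - (⌊s⌋₊ : ℝ)) * rcInv A (ENNReal.ofReal (r ^ (-(n : ℝ))))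

/-- Convergence near zero of `∫_0 (t/A(t))^{(s-(k+1))/(n-(s-(k+1)))} dt`. -/
def IntCondK (n : ℕ) (s : ℝ) (k : ℕ) (A : ℝ → ℝ≥0∞) : Prop :=
  ∃ ε : ℝ, 0 < ε ∧
    ∫⁻ t in Set.Ioc (0 : ℝ) ε,
      (ENNReal.ofReal t / A t) ^ ((s - (k : ℝ) - 1) / ((n : ℝ) - (s - (k : ℝ) - 1))) < ⊤

/-- `P` is the projection polynomial `P^k_B[u]`: it has degree at most `k` and its
derivatives up to order `k` match, in the mean over `B`, the weak derivatives `D` of `u`. -/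
def IsCampPoly (n k : ℕ) (D : (h : ℕ) → Euc n → (Fin h → Fin n) → ℝ)
    (B : Set (Euc n)) (P : MvPolynomial (Fin n) ℝ) : Prop :=
  P.totalDegree ≤ k ∧
  ∀ h : ℕ, h ≤ k → ∀ dirs : Fin h → Fin n,
    ∫ x in B, D h x dirs =
      ∫ x in B,
        iteratedFDeriv ℝ h (fun y : Euc n => MvPolynomial.eval (fun i => y i) P) x
          (fun i => EuclideanSpace.single (dirs i) (1 : ℝ))

/-- The normalized oscillation of order `k` over the ball `B(x,r)`. -/
def oscQuotK (n k : ℕ) (φ : ℝ → ℝ) (u : Euc n → ℝ)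
    (D : (h : ℕ) → Euc n → (Fin h → Fin n) → ℝ) (x : Euc n) (r : ℝ) : ℝ≥0∞ :=
  ⨅ (P : MvPolynomial (Fin n) ℝ) (_ : IsCampPoly n k D (ball x r) P),
    ENNReal.ofReal
      ((φ ((volume (ball x r)).toReal ^ ((n : ℝ)⁻¹)) *
          (volume (ball x r)).toReal ^ ((k : ℝ) / (n : ℝ)))⁻¹ *
        ⨍ y in ball x r, |u y - MvPolynomial.eval (fun i => y i) P|)

/-- The `k`-th order Campanato seminorm `|u|_{𝓛^{k,φ}(ℝⁿ)}`. -/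
def campSemK (n k : ℕ) (φ : ℝ → ℝ) (u : Euc n → ℝ)
    (D : (h : ℕ) → Euc n → (Fin h → Fin n) → ℝ) : ℝ≥0∞ :=
  ⨆ (x : Euc n) (r : ℝ) (_ : 0 < r), oscQuotK n k φ u D x r

/-- The `k`-th order Campanato quantity restricted to balls of measure at most `r`. -/
def campSemKSmall (n k : ℕ) (φ : ℝ → ℝ) (u : Euc n → ℝ)
    (D : (h : ℕ) → Euc n → (Fin h → Fin n) → ℝ) (r : ℝ) : ℝ≥0∞ :=
  ⨆ (x : Euc n) (ρ : ℝ) (_ : 0 < ρ) (_ : volume (ball x ρ) ≤ ENNReal.ofReal r),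
    oscQuotK n k φ u D x ρ

/-- The Luxemburg norm `‖f‖_{L^A(μ)}`. -/
def luxNorm {α : Type*} [MeasurableSpace α] (A : ℝ → ℝ≥0∞) (μ : Measure α)
    (f : α → ℝ) : ℝ≥0∞ :=
  sInf (ENNReal.ofReal '' {lam : ℝ | 0 < lam ∧ ∫⁻ x, A (|f x| / lam) ∂μ ≤ 1})

/-- Iterated integral `∫_r^∞ ∫_{r_1}^∞ ⋯ g`. -/
def iterInt : ℕ → (ℝ → ℝ) → (ℝ → ℝ)
  | 0, g => g
  | j + 1, g => fun r => ∫ t in Set.Ioi r, iterInt j g t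

end
namespace IsYoung

variable {A : ℝ → ℝ≥0∞}

lemma apply_mul_le (hA : IsYoung A) {θ x : ℝ} (h0 : 0 ≤ θ) (h1 : θ ≤ 1) (hx : 0 ≤ x) :
    A (θ * x) ≤ ENNReal.ofReal θ * A x := by
  have h := hA.2.1 x 0 θ hx le_rfl h0 h1
  simpa [hA.1] using h

lemma apply_rcInv_le (hA : IsYoung A) (v : ℝ≥0∞) : A (rcInv A v) ≤ v := by
  have h0 : 0 ≤ rcInv A v := Real.sInf_nonneg fun τ hτ => hτ.1
  rcases h0.eq_or_lt with h | h
  · rw [← h, hA.1]; exact zero_le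
  · have hc : Tendsto A (𝓝[<] (rcInv A v)) (𝓝 (A (rcInv A v))) :=
      (hA.2.2.1 _ h).mono_left (nhdsWithin_mono _ Iio_subset_Iic_self)
    refine le_of_tendsto hc ?_
    filter_upwards [Ioo_mem_nhdsLT h] with t ht
    by_contra hlt
    exact notMem_of_lt_csInf ht.2 ⟨0, fun τ hτ => hτ.1⟩ ⟨ht.1.le, not_le.1 hlt⟩

lemma exists_lt_apply (hA : IsYoung A) {v : ℝ≥0∞} (hv : v ≠ ⊤) : ∃ τ, 0 ≤ τ ∧ v < A τ := by
  obtain ⟨t, ht, hAt⟩ : ∃ t, 0 < t ∧ A t ≠ 0 := by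
    obtain ⟨t₁, t₂, h₁, h₂, hne⟩ := hA.2.2.2
    by_cases h : A t₁ = 0
    · exact ⟨t₂, h₂, fun h' => hne (h.trans h'.symm)⟩
    · exact ⟨t₁, h₁, h⟩
  obtain ⟨N, hN⟩ := ENNReal.exists_nat_mul_gt hAt hv
  have hN0 : N ≠ 0 := by rintro rfl; simp at hN
  have hN1 : (1 : ℝ) ≤ N := by exact_mod_cast Nat.one_le_iff_ne_zero.2 hN0
  refine ⟨N * t, by positivity, hN.trans_le ?_⟩
  have h := hA.apply_mul_le (θ := (N : ℝ)⁻¹) (x := N * t) (by positivity)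
    (inv_le_one_of_one_le₀ hN1) (by positivity)
  rw [inv_mul_cancel_left₀ (by positivity), ENNReal.ofReal_inv_of_pos (by positivity),
    ENNReal.ofReal_natCast] at h
  calc (N : ℝ≥0∞) * A t ≤ N * ((N : ℝ≥0∞)⁻¹ * A (N * t)) := by gcongr
    _ = A (N * t) := ENNReal.mul_inv_cancel_left (by simpa using hN0) (by simp)

lemma rcInv_pos (hA : IsYoung A) {v : ℝ≥0∞} (hv0 : v ≠ 0) (hv : v ≠ ⊤) : 0 < rcInv A v := by
  obtain ⟨t, ht, hAt⟩ : ∃ t, 0 < t ∧ A t ≠ ⊤ := by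
    obtain ⟨t₁, t₂, h₁, h₂, hne⟩ := hA.2.2.2
    by_cases h : A t₁ = ⊤
    · exact ⟨t₂, h₂, fun h' => hne (h.trans h'.symm)⟩
    · exact ⟨t₁, h₁, h⟩
  obtain ⟨N, hN⟩ := ENNReal.exists_nat_mul_gt hv0 hAt
  have hN0 : N ≠ 0 := by rintro rfl; simp at hN
  have hN1 : (1 : ℝ) ≤ N := by exact_mod_cast Nat.one_le_iff_ne_zero.2 hN0
  have hNpos : (0 : ℝ) < N := by positivity
  refine lt_of_lt_of_le (div_pos ht hNpos) (le_csInf (hA.exists_lt_apply hv) ?_)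
  rintro τ ⟨hτ, hvτ⟩
  by_contra! hlt
  rw [lt_div_iff₀ hNpos] at hlt
  have h := hA.apply_mul_le (θ := τ / t) (x := t) (by positivity)
    ((div_le_one ht).2 (by nlinarith)) ht.le
  rw [div_mul_cancel₀ _ ht.ne'] at h
  have h2 : ENNReal.ofReal (τ / t) ≤ (N : ℝ≥0∞)⁻¹ := by
    rw [← ENNReal.ofReal_natCast, ← ENNReal.ofReal_inv_of_pos hNpos]
    apply ENNReal.ofReal_le_ofReal
    rw [div_le_iff₀ ht, inv_mul_eq_div, le_div_iff₀ hNpos]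
    exact hlt.le
  refine hvτ.not_ge (h.trans ?_)
  calc ENNReal.ofReal (τ / t) * A t ≤ (N : ℝ≥0∞)⁻¹ * (N * v) := by gcongr
    _ = v := ENNReal.inv_mul_cancel_left (by simpa using hN0) (by simp)

/-- The convexity bound replacing Jensen's inequality in the oscillation estimate. -/
lemma ofReal_le_rcInv_mul (hA : IsYoung A) {v : ℝ≥0∞} (hv0 : v ≠ 0) (hv : v ≠ ⊤) {t : ℝ}
    (ht : 0 ≤ t) :
    ENNReal.ofReal t ≤ ENNReal.ofReal (rcInv A v) * (1 + A t / v) := by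
  have ha := hA.rcInv_pos hv0 hv
  by_cases hC : 1 + A t / v = ⊤
  · rw [hC, ENNReal.mul_top (by simpa using ha)]; exact le_top
  have hb : ∀ b, rcInv A v < b → ENNReal.ofReal t ≤ ENNReal.ofReal b * (1 + A t / v) := by
    intro b hb
    obtain ⟨τ, ⟨hτ0, hτ⟩, hτb⟩ := exists_lt_of_csInf_lt (hA.exists_lt_apply hv) hb
    refine le_trans ?_ (mul_le_mul_left (ENNReal.ofReal_le_ofReal hτb.le) _)
    rcases le_total t τ with h | h
    · calc ENNReal.ofReal t ≤ ENNReal.ofReal τ * 1 := by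
            rw [mul_one]; exact ENNReal.ofReal_le_ofReal h
        _ ≤ _ := by gcongr; exact le_self_add
    · rcases ht.eq_or_lt with h0 | h0
      · simp [← h0]
      have h1 := hA.apply_mul_le (θ := τ / t) (x := t) (by positivity) ((div_le_one h0).2 h) ht
      rw [div_mul_cancel₀ _ h0.ne'] at h1
      calc ENNReal.ofReal t = ENNReal.ofReal t * (v / v) := by
            rw [ENNReal.div_self hv0 hv, mul_one]
        _ ≤ ENNReal.ofReal t * ((ENNReal.ofReal (τ / t) * A t) / v) := by
            gcongr; exact hτ.le.trans h1
        _ = (ENNReal.ofReal t * ENNReal.ofReal (τ / t)) * (A t / v) := by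
            rw [mul_div_assoc, mul_assoc]
        _ = ENNReal.ofReal τ * (A t / v) := by
            rw [← ENNReal.ofReal_mul ht, mul_div_cancel₀ _ h0.ne']
        _ ≤ _ := by gcongr; exact le_add_self
  have hlim : Tendsto (fun b => ENNReal.ofReal b * (1 + A t / v)) (𝓝[>] (rcInv A v))
      (𝓝 (ENNReal.ofReal (rcInv A v) * (1 + A t / v))) :=
    ENNReal.Tendsto.mul_const
      ((ENNReal.continuous_ofReal.tendsto _).mono_left nhdsWithin_le_nhds) (Or.inr hC)
  exact ge_of_tendsto hlim (by filter_upwards [self_mem_nhdsWithin] with b hb' using hb b hb')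

end IsYoung

lemma ofReal_integral_abs_sub_integral_le {α : Type*} [MeasurableSpace α] {ν : Measure α}
    [IsProbabilityMeasure ν] {u : α → ℝ} (hu : AEStronglyMeasurable u ν) :
    ENNReal.ofReal (∫ y, |u y - ∫ z, u z ∂ν| ∂ν) ≤ ∫⁻ y, ∫⁻ z, ‖u y - u z‖ₑ ∂ν ∂ν := by
  by_cases h : Integrable u ν
  · calc ENNReal.ofReal (∫ y, |u y - ∫ z, u z ∂ν| ∂ν)
        ≤ ‖∫ y, |u y - ∫ z, u z ∂ν| ∂ν‖ₑ := Real.ofReal_le_enorm _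
      _ ≤ ∫⁻ y, ‖|u y - ∫ z, u z ∂ν|‖ₑ ∂ν := enorm_integral_le_lintegral_enorm _
      _ ≤ _ := by
        refine lintegral_mono fun y => ?_
        have : u y - ∫ z, u z ∂ν = ∫ z, (u y - u z) ∂ν := by
          rw [integral_sub (integrable_const _) h]; simp
        rw [this, ← Real.norm_eq_abs, enorm_norm]
        exact enorm_integral_le_lintegral_enorm _
  · have h' : ¬ Integrable (fun y => |u y|) ν := fun hh => h ((integrable_norm_iff hu).1 hh)
    simp [integral_undef h, integral_undef h']

/-- The side length `|B₁|^{1/n}` of a cube with the volume of the unit ball. -/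
noncomputable def unitBallSide (n : ℕ) : ℝ := (volume (ball (0 : Euc n) 1)).toReal ^ ((n : ℝ)⁻¹)

lemma unitBallSide_pos (n : ℕ) : 0 < unitBallSide n :=
  Real.rpow_pos_of_pos (ENNReal.toReal_pos (measure_ball_pos _ _ one_pos).ne'
    measure_ball_lt_top.ne) _

lemma volume_ball_eq {n : ℕ} (hn : 0 < n) (x : Euc n) {ρ : ℝ} (hρ : 0 < ρ) :
    volume (ball x ρ) = ENNReal.ofReal ((unitBallSide n * ρ) ^ (n : ℝ)) := by
  rw [Measure.addHaar_ball_of_pos _ _ hρ, Real.mul_rpow (unitBallSide_pos n).le hρ.le, mul_comm,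
    ENNReal.ofReal_mul (by have := unitBallSide_pos n; positivity), unitBallSide,
    ← Real.rpow_mul ENNReal.toReal_nonneg, inv_mul_cancel₀ (by positivity), Real.rpow_one,
    ENNReal.ofReal_toReal measure_ball_lt_top.ne]
  simp

lemma volume_ball_rpow_inv {n : ℕ} (hn : 0 < n) (x : Euc n) {ρ : ℝ} (hρ : 0 < ρ) :
    (volume (ball x ρ)).toReal ^ ((n : ℝ)⁻¹) = unitBallSide n * ρ := by
  have := unitBallSide_pos n
  rw [volume_ball_eq hn x hρ, ENNReal.toReal_ofReal (by positivity),
    ← Real.rpow_mul (by positivity), mul_inv_cancel₀ (by positivity), Real.rpow_one]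

lemma oscQuot_const_mul (n : ℕ) (φ : ℝ → ℝ) (u : Euc n → ℝ) (x : Euc n) (r : ℝ) {c : ℝ}
    (hc : 0 ≤ c) : oscQuot n φ (fun y => c * u y) x r = c * oscQuot n φ u x r := by
  have h (y) : |c * u y - ⨍ z in ball x r, c * u z| = c * |u y - ⨍ z in ball x r, u z| := by
    rw [average, integral_const_mul, ← mul_sub, abs_mul, abs_of_nonneg hc]
    rfl
  simp only [oscQuot, h]
  rw [average, integral_const_mul, mul_left_comm]
  rfl

lemma Jfun_fin_one (n : ℕ) (σ : ℝ) (A : ℝ → ℝ≥0∞) (u : Euc n → ℝ) :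
    Jfun n σ A (fun x (_ : Fin 1) => u x) =
      ∫⁻ x : Euc n, ∫⁻ y : Euc n,
        A (|u x - u y| / ‖x - y‖ ^ σ) / ENNReal.ofReal (‖x - y‖ ^ (n : ℝ)) := by
  simp [Jfun, Real.sqrt_sq_eq_abs]

lemma enorm_sub_le_of_dist_lt {n : ℕ} {s : ℝ} (hs : 0 < s) {A : ℝ → ℝ≥0∞} (hA : IsYoung A)
    {v : ℝ≥0∞} (hv0 : v ≠ 0) (hv : v ≠ ⊤) (u : Euc n → ℝ) {x y : Euc n} {d : ℝ}
    (hd : ‖x - y‖ ≤ d) :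
    ‖u x - u y‖ₑ ≤ ENNReal.ofReal (d ^ s * rcInv A v) *
      (1 + ENNReal.ofReal (d ^ (n : ℝ)) / v *
        (A (|u x - u y| / ‖x - y‖ ^ s) / ENNReal.ofReal (‖x - y‖ ^ (n : ℝ)))) := by
  rcases eq_or_ne x y with rfl | hxy
  · simp
  have hh : 0 < ‖x - y‖ := norm_pos_iff.2 (sub_ne_zero.2 hxy)
  have hd0 : 0 < d := hh.trans_le hd
  set h := ‖x - y‖
  set t := |u x - u y| / h ^ s with ht
  have ht0 : 0 ≤ t := by positivity
  have hn0 : ENNReal.ofReal (h ^ (n : ℝ)) ≠ 0 := by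
    simpa using Real.rpow_pos_of_pos hh (n : ℝ)
  have h1 : |u x - u y| ≤ d ^ s * t := by
    have : |u x - u y| = h ^ s * t := by
      rw [ht, mul_div_cancel₀]; positivity
    rw [this]
    gcongr
  have h2 : A t ≤ ENNReal.ofReal (d ^ (n : ℝ)) * (A t / ENNReal.ofReal (h ^ (n : ℝ))) := by
    calc A t = ENNReal.ofReal (h ^ (n : ℝ)) * (A t / ENNReal.ofReal (h ^ (n : ℝ))) :=
          (ENNReal.mul_div_cancel hn0 ENNReal.ofReal_ne_top).symm
      _ ≤ _ := by gcongr
  calc ‖u x - u y‖ₑ = ENNReal.ofReal |u x - u y| := by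
        rw [Real.enorm_eq_ofReal_abs]
    _ ≤ ENNReal.ofReal (d ^ s) * ENNReal.ofReal t := by
        rw [← ENNReal.ofReal_mul (by positivity)]
        exact ENNReal.ofReal_le_ofReal h1
    _ ≤ ENNReal.ofReal (d ^ s) * (ENNReal.ofReal (rcInv A v) * (1 + A t / v)) := by
        gcongr
        exact hA.ofReal_le_rcInv_mul hv0 hv ht0
    _ ≤ ENNReal.ofReal (d ^ s) * (ENNReal.ofReal (rcInv A v) *
          (1 + (ENNReal.ofReal (d ^ (n : ℝ)) * (A t / ENNReal.ofReal (h ^ (n : ℝ)))) / v)) := by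
        gcongr
    _ = _ := by
        rw [ENNReal.ofReal_mul (by positivity), mul_assoc]
        simp only [div_eq_mul_inv]
        ring

/-- The constant in the mean oscillation estimate for functions of unit energy. -/
noncomputable def oscConst (n : ℕ) (s : ℝ) : ℝ :=
  (2 / unitBallSide n) ^ s * (1 + (2 / unitBallSide n) ^ (n : ℝ))

lemma oscConst_pos (n : ℕ) (s : ℝ) : 0 < oscConst n s := by
  have := unitBallSide_pos n
  unfold oscConst
  positivity

lemma setAverage_osc_le {n : ℕ} (hn : 0 < n) {s : ℝ} (hs : 0 < s) {A : ℝ → ℝ≥0∞}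
    (hA : IsYoung A) {u : Euc n → ℝ} (hu : Measurable u)
    (hJ : Jfun n s A (fun x (_ : Fin 1) => u x) ≤ 1) (x : Euc n) {ρ : ℝ} (hρ : 0 < ρ) :
    ENNReal.ofReal (⨍ y in ball x ρ, |u y - ⨍ z in ball x ρ, u z|) ≤
      ENNReal.ofReal (oscConst n s * phiSA n s A (unitBallSide n * ρ)) := by
  have hκ := unitBallSide_pos n
  set κ := unitBallSide n with hκdef
  have hr : 0 < κ * ρ := by positivity
  set v : ℝ≥0∞ := ENNReal.ofReal ((κ * ρ) ^ (-(n : ℝ))) with hvdef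
  have hv0 : v ≠ 0 := by simpa [hvdef] using Real.rpow_pos_of_pos hr (-(n : ℝ))
  have hv : v ≠ ⊤ := ENNReal.ofReal_ne_top
  have hvol : (volume (ball x ρ))⁻¹ = v := by
    rw [volume_ball_eq hn x hρ, hvdef, Real.rpow_neg hr.le,
      ENNReal.ofReal_inv_of_pos (by positivity)]
  set F : Euc n → Euc n → ℝ≥0∞ := fun x y =>
    A (|u x - u y| / ‖x - y‖ ^ s) / ENNReal.ofReal (‖x - y‖ ^ (n : ℝ)) with hF
  rw [Jfun_fin_one] at hJ
  set ν : Measure (Euc n) := v • volume.restrict (ball x ρ) with hν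
  have hνav : ∀ f : Euc n → ℝ, ⨍ y in ball x ρ, f y = ∫ y, f y ∂ν := by
    intro f
    rw [average, Measure.restrict_apply_univ, hvol]
  have : IsProbabilityMeasure ν := ⟨by
    rw [hν, Measure.smul_apply, Measure.restrict_apply_univ, smul_eq_mul, ← hvol]
    exact ENNReal.inv_mul_cancel (measure_ball_pos _ _ hρ).ne' measure_ball_lt_top.ne⟩
  simp only [hνav]
  refine (ofReal_integral_abs_sub_integral_le hu.aestronglyMeasurable).trans ?_
  set K : ℝ≥0∞ := ENNReal.ofReal ((2 * ρ) ^ s * rcInv A v) with hK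
  set M : ℝ≥0∞ := ENNReal.ofReal ((2 * ρ) ^ (n : ℝ)) / v with hM
  have hMtop : M ≠ ⊤ := ENNReal.div_ne_top ENNReal.ofReal_ne_top hv0
  have hae : ∀ᵐ y ∂ν, y ∈ ball x ρ :=
    Measure.ae_smul_measure (ae_restrict_mem measurableSet_ball) v
  have hin : ∀ f : Euc n → ℝ≥0∞, ∫⁻ z, f z ∂ν ≤ v * ∫⁻ z, f z := by
    intro f
    rw [hν, lintegral_smul_measure, smul_eq_mul]
    gcongr
    exact Measure.restrict_le_self
  have hKtop : K ≠ ⊤ := ENNReal.ofReal_ne_top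
  calc ∫⁻ y, ∫⁻ z, ‖u y - u z‖ₑ ∂ν ∂ν
      ≤ ∫⁻ y, ∫⁻ z, K * (1 + M * F y z) ∂ν ∂ν := by
        refine lintegral_mono_ae ?_
        filter_upwards [hae] with y hy
        refine lintegral_mono_ae ?_
        filter_upwards [hae] with z hz
        refine enorm_sub_le_of_dist_lt hs hA hv0 hv u ?_
        rw [← dist_eq_norm, two_mul]
        exact (dist_triangle_right y z x).trans (add_le_add hy.le hz.le)
    _ = K * (1 + M * ∫⁻ y, ∫⁻ z, F y z ∂ν ∂ν) := by
        simp only [lintegral_const_mul' _ _ hKtop, lintegral_add_left measurable_const,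
          lintegral_const_mul' _ _ hMtop, lintegral_const, measure_univ, mul_one]
    _ ≤ K * (1 + M * (v * (v * 1))) := by
        gcongr
        refine (hin _).trans ?_
        gcongr
        calc ∫⁻ y, ∫⁻ z, F y z ∂ν ≤ ∫⁻ y, v * ∫⁻ z, F y z := lintegral_mono fun y => hin _
          _ = v * ∫⁻ y, ∫⁻ z, F y z := lintegral_const_mul' _ _ hv
          _ ≤ v * 1 := by gcongr
    _ = K * (1 + ENNReal.ofReal ((2 * ρ) ^ (n : ℝ)) * v) := by
        rw [hM, mul_one, ← mul_assoc, ENNReal.div_mul_cancel hv0 hv]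
    _ = _ := by
        have ha : 0 ≤ rcInv A v := (hA.rcInv_pos hv0 hv).le
        rw [hK, hvdef, ← ENNReal.ofReal_mul (by positivity), ← ENNReal.ofReal_one,
          ← ENNReal.ofReal_add (by positivity) (by positivity),
          ← ENNReal.ofReal_mul (by positivity)]
        congr 1
        rw [← hvdef, oscConst, phiSA, ← hκdef, ← hvdef]
        have h2 : 2 * ρ = (2 / κ) * (κ * ρ) := by field_simp
        have h3 : (κ * ρ) ^ (n : ℝ) * (κ * ρ) ^ (-(n : ℝ)) = 1 := by
          rw [← Real.rpow_add hr]; simp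
        rw [h2, Real.mul_rpow (by positivity) hr.le, Real.mul_rpow (by positivity) hr.le,
          mul_assoc _ _ ((κ * ρ) ^ (-(n : ℝ))), h3]
        ring

/-- The radial profile bounding the energy density of the unit bump function. -/
noncomputable def bumpKernel (n : ℕ) (s k : ℝ) : ℝ := min (k ^ (1 - s)) (k ^ (-s)) * k ^ (-(n : ℝ))

lemma lintegral_bumpKernel_lt_top {n : ℕ} (hn : 0 < n) {s : ℝ} (hs : s ∈ Ioo (0 : ℝ) 1) :
    ∫⁻ h : Euc n, ENNReal.ofReal (bumpKernel n s ‖h‖) < ⊤ := by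
  have : Nontrivial (Euc n) := by
    have : Nonempty (Fin n) := ⟨⟨0, hn⟩⟩
    infer_instance
  have hmeas : Measurable (fun y : ℝ => y ^ (n - 1) • bumpKernel n s y) := by
    unfold bumpKernel
    fun_prop
  have key : ∀ y : ℝ, 0 < y → y ^ (n - 1) • bumpKernel n s y = min (y ^ (-s)) (y ^ (-s - 1)) := by
    intro y hy
    rw [smul_eq_mul, bumpKernel, mul_comm, mul_assoc, ← Real.rpow_natCast y (n - 1),
      ← Real.rpow_add hy, Nat.cast_sub (Nat.one_le_iff_ne_zero.2 hn.ne'),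
      min_mul_of_nonneg _ _ (by positivity), ← Real.rpow_add hy, ← Real.rpow_add hy]
    congr 2 <;> push_cast <;> ring
  have hint : Integrable (fun h : Euc n => bumpKernel n s ‖h‖) := by
    rw [integrable_fun_norm_addHaar volume (f := bumpKernel n s), finrank_euclideanSpace_fin,
      ← Ioc_union_Ioi_eq_Ioi zero_le_one]
    refine IntegrableOn.union ?_ ?_
    · have h1 : IntegrableOn (fun y : ℝ => y ^ (-s)) (Ioc 0 1) := by
        rw [integrableOn_Ioc_iff_integrableOn_Ioo,
          intervalIntegral.integrableOn_Ioo_rpow_iff zero_lt_one]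
        linarith [hs.2]
      refine Integrable.mono' h1 hmeas.aestronglyMeasurable ?_
      filter_upwards [ae_restrict_mem measurableSet_Ioc] with y hy
      have := hy.1
      rw [key y hy.1, Real.norm_of_nonneg (by positivity)]
      exact min_le_left _ _
    · have h1 : IntegrableOn (fun y : ℝ => y ^ (-s - 1)) (Ioi 1) :=
        integrableOn_Ioi_rpow_of_lt (by linarith [hs.1]) one_pos
      refine Integrable.mono' h1 hmeas.aestronglyMeasurable ?_
      filter_upwards [ae_restrict_mem measurableSet_Ioi] with y hy
      have hy0 : (0 : ℝ) < y := one_pos.trans hy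
      rw [key y hy0, Real.norm_of_nonneg (by positivity)]
      exact min_le_right _ _
  exact hint.lintegral_lt_top

/-- The Lipschitz bump function supported in the ball of radius `R`. -/
noncomputable def bump (n : ℕ) (R : ℝ) (x : Euc n) : ℝ := max 0 (1 - ‖x‖ / R)

lemma continuous_bump (n : ℕ) (R : ℝ) : Continuous (bump n R) := by
  unfold bump
  fun_prop

lemma abs_bump_sub_le_one {n : ℕ} {R : ℝ} (hR : 0 < R) (x y : Euc n) :
    |bump n R x - bump n R y| ≤ 1 := by
  have h : ∀ z : Euc n, 0 ≤ bump n R z ∧ bump n R z ≤ 1 := fun z =>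
    ⟨le_max_left _ _, max_le zero_le_one (by have : 0 ≤ ‖z‖ / R := by positivity
                                             linarith)⟩
  rw [abs_le]
  constructor <;> linarith [(h x).1, (h x).2, (h y).1, (h y).2]

lemma abs_bump_sub_le {n : ℕ} {R : ℝ} (hR : 0 < R) (x y : Euc n) :
    |bump n R x - bump n R y| ≤ ‖x - y‖ / R := by
  refine (abs_max_sub_max_le_max _ _ _ _).trans ?_
  rw [sub_self, abs_zero, max_eq_right (abs_nonneg _), sub_sub_sub_cancel_left, ← sub_div, abs_div,
    abs_of_pos hR]
  gcongr
  rw [norm_sub_rev]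
  exact abs_norm_sub_norm_le _ _

lemma bump_eq_zero {n : ℕ} {R : ℝ} (hR : 0 < R) {x : Euc n} (hx : x ∉ ball (0 : Euc n) R) :
    bump n R x = 0 := by
  refine max_eq_left ?_
  rw [mem_ball_zero_iff, not_lt] at hx
  rw [sub_nonpos, le_div_iff₀ hR, one_mul]
  exact hx

lemma density_bump_le {n : ℕ} {s : ℝ} {A : ℝ → ℝ≥0∞} (hA : IsYoung A)
    {a R : ℝ} (ha : 0 ≤ a) (hR : 0 < R) (hs : s ∈ Ioo (0 : ℝ) 1) (x y : Euc n) :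
    A (|R ^ s * a * bump n R x - R ^ s * a * bump n R y| / ‖x - y‖ ^ s) /
        ENNReal.ofReal (‖x - y‖ ^ (n : ℝ)) ≤
      ((ball 0 R).indicator 1 x + (ball 0 R).indicator 1 y) *
        (A a * ENNReal.ofReal (R ^ (-(n : ℝ))) *
          ENNReal.ofReal (bumpKernel n s ‖R⁻¹ • (x - y)‖)) := by
  rcases eq_or_ne x y with rfl | hxy
  · simp [hA.1]
  by_cases hB : x ∉ ball (0 : Euc n) R ∧ y ∉ ball (0 : Euc n) R
  · simp [bump_eq_zero hR hB.1, bump_eq_zero hR hB.2, hA.1]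
  have hone : (1 : ℝ≥0∞) ≤ (ball (0 : Euc n) R).indicator 1 x + (ball 0 R).indicator 1 y := by
    by_cases hx : x ∈ ball (0 : Euc n) R
    · rw [indicator_of_mem hx]; exact le_self_add
    · have hy : y ∈ ball (0 : Euc n) R := by tauto
      rw [indicator_of_mem hy]; exact le_add_self
  refine le_trans ?_ (mul_le_mul_left hone _)
  rw [one_mul]
  have hh : 0 < ‖x - y‖ := norm_pos_iff.2 (sub_ne_zero.2 hxy)
  have hk : ‖R⁻¹ • (x - y)‖ = ‖x - y‖ / R := by
    rw [norm_smul, Real.norm_of_nonneg (by positivity), inv_mul_eq_div]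
  rw [hk]
  set h := ‖x - y‖
  set k := h / R with hkdef
  have hk0 : 0 < k := by positivity
  have hkh : h = R * k := by rw [hkdef]; field_simp
  set D := |bump n R x - bump n R y| with hD
  have hθ : D * k ^ (-s) ≤ min (k ^ (1 - s)) (k ^ (-s)) := by
    refine le_min ?_ ?_
    · calc D * k ^ (-s) ≤ k * k ^ (-s) := by gcongr; exact abs_bump_sub_le hR x y
        _ = k ^ (1 - s) := by
          rw [sub_eq_add_neg, Real.rpow_add hk0, Real.rpow_one]
    · exact mul_le_of_le_one_left (by positivity) (abs_bump_sub_le_one hR x y)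
  have hmin : min (k ^ (1 - s)) (k ^ (-s)) ≤ 1 := by
    rcases le_total k 1 with h1 | h1
    · exact (min_le_left _ _).trans (Real.rpow_le_one hk0.le h1 (by linarith [hs.2]))
    · exact (min_le_right _ _).trans
        (Real.rpow_le_one_of_one_le_of_nonpos h1 (by linarith [hs.1]))
  have harg : |R ^ s * a * bump n R x - R ^ s * a * bump n R y| / h ^ s = D * k ^ (-s) * a := by
    rw [← mul_sub, abs_mul, ← hD, abs_of_nonneg (by positivity), hkh, Real.mul_rpow hR.le hk0.le,
      Real.rpow_neg hk0.le]
    field_simp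
  rw [harg, div_eq_mul_inv, ← ENNReal.ofReal_inv_of_pos (by positivity), ← Real.rpow_neg hh.le]
  calc A (D * k ^ (-s) * a) * ENNReal.ofReal (h ^ (-(n : ℝ)))
      ≤ (ENNReal.ofReal (D * k ^ (-s)) * A a) * ENNReal.ofReal (h ^ (-(n : ℝ))) := by
        gcongr
        exact hA.apply_mul_le (by positivity) (hθ.trans hmin) ha
    _ ≤ (ENNReal.ofReal (min (k ^ (1 - s)) (k ^ (-s))) * A a) *
          ENNReal.ofReal (h ^ (-(n : ℝ))) := by gcongr
    _ = _ := by
        rw [hkh, Real.mul_rpow hR.le hk0.le, ENNReal.ofReal_mul (by positivity), bumpKernel,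
          ENNReal.ofReal_mul (by positivity)]
        ring

lemma Jfun_bump_le {n : ℕ} (hn : 0 < n) {s : ℝ} (hs : s ∈ Ioo (0 : ℝ) 1) {A : ℝ → ℝ≥0∞}
    (hA : IsYoung A) {R : ℝ} (hR : 0 < R) :
    Jfun n s A (fun x (_ : Fin 1) => R ^ s *
        rcInv A (ENNReal.ofReal ((unitBallSide n * R) ^ (-(n : ℝ)))) * bump n R x) ≤
      2 * ∫⁻ h : Euc n, ENNReal.ofReal (bumpKernel n s ‖h‖) := by
  have hκ := unitBallSide_pos n
  set v := ENNReal.ofReal ((unitBallSide n * R) ^ (-(n : ℝ))) with hv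
  set a := rcInv A v
  have ha : 0 ≤ a := Real.sInf_nonneg fun τ hτ => hτ.1
  set G : Euc n → ℝ≥0∞ := fun h => ENNReal.ofReal (bumpKernel n s ‖h‖) with hG
  have hGm : Measurable G := by
    have : Measurable (bumpKernel n s) := by unfold bumpKernel; fun_prop
    fun_prop
  set H : Euc n → ℝ≥0∞ := fun h => A a * ENNReal.ofReal (R ^ (-(n : ℝ))) * G (R⁻¹ • h) with hH
  have hHm : Measurable H := by fun_prop
  have hHint : ∫⁻ h, H h = A a * ∫⁻ h, G h := by
    have h1 : ∫⁻ h, G (R⁻¹ • h) = ENNReal.ofReal (R ^ (n : ℝ)) * ∫⁻ h, G h := by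
      rw [← lintegral_map hGm (measurable_const_smul R⁻¹),
        Measure.map_addHaar_smul volume (inv_ne_zero hR.ne'), lintegral_smul_measure, smul_eq_mul,
        finrank_euclideanSpace_fin, inv_pow, inv_inv, abs_of_pos (by positivity),
        Real.rpow_natCast]
    rw [hH, lintegral_const_mul _ (by fun_prop), h1, Real.rpow_neg hR.le,
      ENNReal.ofReal_inv_of_pos (by positivity), mul_assoc,
      ENNReal.inv_mul_cancel_left (by simpa using Real.rpow_pos_of_pos hR (n : ℝ))
        ENNReal.ofReal_ne_top]
  have hvol : volume (ball (0 : Euc n) R) * v = 1 := by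
    rw [volume_ball_eq hn 0 hR, hv, ← ENNReal.ofReal_mul (by positivity),
      ← Real.rpow_add (by positivity)]
    simp
  have hind : Measurable ((ball (0 : Euc n) R).indicator (1 : Euc n → ℝ≥0∞)) :=
    measurable_one.indicator measurableSet_ball
  have hx : ∫⁻ x : Euc n, ∫⁻ y : Euc n, (ball 0 R).indicator 1 x * H (x - y) =
      volume (ball (0 : Euc n) R) * ∫⁻ h, H h := by
    have : ∀ x : Euc n, ∫⁻ y : Euc n, (ball 0 R).indicator 1 x * H (x - y) =
        (ball 0 R).indicator 1 x * ∫⁻ h, H h := by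
      intro x
      rw [lintegral_const_mul _ (by fun_prop), lintegral_sub_left_eq_self]
    simp only [this]
    rw [lintegral_mul_const _ hind, lintegral_indicator_one measurableSet_ball]
  have hy : ∫⁻ x : Euc n, ∫⁻ y : Euc n, (ball 0 R).indicator 1 y * H (x - y) =
      volume (ball (0 : Euc n) R) * ∫⁻ h, H h := by
    rw [lintegral_lintegral_swap (by fun_prop)]
    have : ∀ y : Euc n, ∫⁻ x : Euc n, (ball 0 R).indicator 1 y * H (x - y) =
        (ball 0 R).indicator 1 y * ∫⁻ h, H h := by
      intro y
      rw [lintegral_const_mul _ (by fun_prop), lintegral_sub_right_eq_self]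
    simp only [this]
    rw [lintegral_mul_const _ hind, lintegral_indicator_one measurableSet_ball]
  rw [Jfun_fin_one n s A (fun x => R ^ s * a * bump n R x)]
  calc _ ≤ ∫⁻ x : Euc n, ∫⁻ y : Euc n,
        ((ball 0 R).indicator 1 x * H (x - y) + (ball 0 R).indicator 1 y * H (x - y)) := by
        refine lintegral_mono fun x => lintegral_mono fun y => ?_
        rw [← add_mul]
        exact density_bump_le hA ha hR hs x y
    _ = (∫⁻ x : Euc n, ∫⁻ y : Euc n, (ball 0 R).indicator 1 x * H (x - y)) +
        ∫⁻ x : Euc n, ∫⁻ y : Euc n, (ball 0 R).indicator 1 y * H (x - y) := by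
        rw [← lintegral_add_left]
        · refine lintegral_congr fun x => ?_
          rw [lintegral_add_left (by fun_prop)]
        · exact Measurable.lintegral_prod_right' (f := fun p : Euc n × Euc n =>
            (ball 0 R).indicator 1 p.1 * H (p.1 - p.2)) (by fun_prop)
    _ = 2 * (volume (ball (0 : Euc n) R) * (A a * ∫⁻ h, G h)) := by
        rw [hx, hy, hHint, two_mul]
    _ ≤ 2 * (volume (ball (0 : Euc n) R) * (v * ∫⁻ h, G h)) := by
        gcongr
        exact hA.apply_rcInv_le v
    _ = _ := by rw [← mul_assoc _ v, hvol, one_mul]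

lemma Jfun_const_mul_le (n : ℕ) (s : ℝ) {A : ℝ → ℝ≥0∞} (hA : IsYoung A) (u : Euc n → ℝ)
    {θ : ℝ} (h0 : 0 ≤ θ) (h1 : θ ≤ 1) :
    Jfun n s A (fun x (_ : Fin 1) => θ * u x) ≤
      ENNReal.ofReal θ * Jfun n s A (fun x (_ : Fin 1) => u x) := by
  rw [Jfun_fin_one n s A u, Jfun_fin_one n s A (fun x => θ * u x)]
  simp only [← lintegral_const_mul' _ _ (ENNReal.ofReal_ne_top (r := θ))]
  refine lintegral_mono fun x => lintegral_mono fun y => ?_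
  rw [← mul_sub, abs_mul, abs_of_nonneg h0, mul_div_assoc]
  refine le_of_le_of_eq (ENNReal.div_le_div_right ?_ _) (mul_div_assoc _ _ _)
  exact hA.apply_mul_le h0 h1 (by positivity)

lemma mul_measureReal_le_setIntegral {n : ℕ} {f : Euc n → ℝ} {S B : Set (Euc n)}
    (hf : IntegrableOn f B) (hf0 : ∀ x, 0 ≤ f x) (hS : MeasurableSet S) (hSB : S ⊆ B)
    (hB : volume B ≠ ⊤) {c : ℝ} (hc : ∀ x ∈ S, c ≤ f x) :
    c * volume.real S ≤ ∫ x in B, f x :=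
  (setIntegral_ge_of_const_le_real hS (ne_top_of_le_ne_top hB (measure_mono hSB)) hc
    (hf.mono_set hSB)).trans
    (setIntegral_mono_set hf (Eventually.of_forall hf0) hSB.eventuallyLE)

/-- A lower bound for the mean oscillation of the bump function on its supporting ball. -/
noncomputable def bumpOsc (n : ℕ) : ℝ := 8⁻¹ * min ((1 / 2) ^ n) (1 - (3 / 4) ^ n)

lemma bumpOsc_pos {n : ℕ} (hn : 0 < n) : 0 < bumpOsc n := by
  have : (3 / 4 : ℝ) ^ n < 1 := pow_lt_one₀ (by norm_num) (by norm_num) hn.ne'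
  have : 0 < min ((1 / 2 : ℝ) ^ n) (1 - (3 / 4) ^ n) := lt_min (by positivity) (by linarith)
  unfold bumpOsc
  positivity

lemma bumpOsc_le_setAverage {n : ℕ} (hn : 0 < n) {R : ℝ} (hR : 0 < R) (m : ℝ) :
    bumpOsc n ≤ ⨍ y in ball (0 : Euc n) R, |bump n R y - m| := by
  have hκ := unitBallSide_pos n
  have hvol : ∀ q : ℝ, 0 < q → volume.real (ball (0 : Euc n) (q * R)) =
      q ^ n * volume.real (ball (0 : Euc n) R) := by
    intro q hq
    rw [measureReal_def, measureReal_def, volume_ball_eq hn 0 (mul_pos hq hR),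
      volume_ball_eq hn 0 hR, ENNReal.toReal_ofReal (by positivity),
      ENNReal.toReal_ofReal (by positivity), Real.rpow_natCast, Real.rpow_natCast]
    ring
  have hV : 0 < volume.real (ball (0 : Euc n) R) :=
    ENNReal.toReal_pos (measure_ball_pos _ _ hR).ne' measure_ball_lt_top.ne
  have hint : IntegrableOn (fun y => |bump n R y - m|) (ball (0 : Euc n) R) :=
    (((continuous_bump n R).sub continuous_const).abs.continuousOn.integrableOn_compact
      (isCompact_closedBall (0 : Euc n) R)).mono_set ball_subset_closedBall
  have hsub : ∀ q : ℝ, q ≤ 1 → ball (0 : Euc n) (q * R) ⊆ ball 0 R := fun q hq =>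
    ball_subset_ball (mul_le_of_le_one_left hR.le hq)
  rw [setAverage_eq, smul_eq_mul, inv_mul_eq_div, le_div_iff₀ hV, bumpOsc, mul_assoc]
  rcases le_total m (3 / 8) with hm | hm
  · refine le_trans ?_ (mul_measureReal_le_setIntegral hint (fun _ => abs_nonneg _)
      (measurableSet_ball (x := 0) (ε := 1 / 2 * R)) (hsub _ (by norm_num))
      measure_ball_lt_top.ne (c := 8⁻¹) ?_)
    · rw [hvol _ (by norm_num)]
      gcongr
      exact min_le_left _ _
    · intro x hx
      rw [mem_ball_zero_iff, ← div_lt_iff₀ hR] at hx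
      have : 1 - ‖x‖ / R ≤ bump n R x := le_max_right _ _
      exact le_trans (by linarith) (le_abs_self _)
  · refine le_trans ?_ (mul_measureReal_le_setIntegral hint (fun _ => abs_nonneg _)
      (measurableSet_ball.diff (measurableSet_ball (x := 0) (ε := 3 / 4 * R))) sdiff_subset
      measure_ball_lt_top.ne (c := 8⁻¹) ?_)
    · rw [measureReal_sdiff (hsub _ (by norm_num)) measurableSet_ball, hvol _ (by norm_num),
        ← one_sub_mul]
      gcongr
      exact min_le_right _ _
    · rintro x ⟨-, hx⟩
      rw [mem_ball_zero_iff, ← div_lt_iff₀ hR, not_lt] at hx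
      have : bump n R x ≤ 1 / 4 := max_le (by norm_num) (by linarith)
      exact le_trans (by linarith) (neg_le_abs _)

lemma oscQuot_le {n : ℕ} (hn : 0 < n) {s : ℝ} (hs : 0 < s) {A : ℝ → ℝ≥0∞} (hA : IsYoung A)
    {φ : ℝ → ℝ} (hφ : Admissible φ) {u : Euc n → ℝ} (hu : Measurable u) {lam : ℝ} (hl : 0 < lam)
    (hJ : Jfun n s A (fun x (_ : Fin 1) => u x / lam) ≤ 1) (x : Euc n) {ρ : ℝ} (hρ : 0 < ρ) :
    oscQuot n φ u x ρ ≤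
      lam * (oscConst n s * (phiSA n s A (unitBallSide n * ρ) / φ (unitBallSide n * ρ))) := by
  have hκ := unitBallSide_pos n
  have hφ0 : 0 < φ (unitBallSide n * ρ) := hφ.1 _ (by positivity)
  have hphi : 0 ≤ phiSA n s A (unitBallSide n * ρ) :=
    mul_nonneg (by positivity) (Real.sInf_nonneg fun τ hτ => hτ.1)
  have hC := oscConst_pos n s
  have hosc := (ENNReal.ofReal_le_ofReal_iff (by positivity)).1
    (setAverage_osc_le hn hs hA (hu.div_const lam) hJ x hρ)
  have h : oscQuot n φ u x ρ = lam * oscQuot n φ (fun y => u y / lam) x ρ := by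
    rw [← oscQuot_const_mul _ _ _ _ _ hl.le]
    congr 1
    ext y
    field_simp
  rw [h, oscQuot, volume_ball_rpow_inv hn x hρ]
  refine mul_le_mul_of_nonneg_left ?_ hl.le
  rw [inv_mul_eq_div, mul_div_assoc']
  gcongr

lemma le_ofReal_mul_fracSemS {n : ℕ} {s : ℝ} {A : ℝ → ℝ≥0∞} {u : Euc n → ℝ} {C : ℝ} (hC : 0 < C)
    {X : ℝ≥0∞} (h : ∀ lam : ℝ, 0 < lam → Jfun n s A (fun x (_ : Fin 1) => u x / lam) ≤ 1 →
      X ≤ ENNReal.ofReal (lam * C)) :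
    X ≤ ENNReal.ofReal C * fracSemS n s A u := by
  rw [mul_comm]
  refine (ENNReal.div_le_iff (by simpa using hC) ENNReal.ofReal_ne_top).1 (le_sInf ?_)
  rintro _ ⟨lam, ⟨hl, hJ⟩, rfl⟩
  refine ENNReal.div_le_of_le_mul ?_
  rw [← ENNReal.ofReal_mul hl.le]
  exact h lam hl hJ

lemma phiSA_pos (n : ℕ) (s : ℝ) {A : ℝ → ℝ≥0∞} (hA : IsYoung A) {r : ℝ} (hr : 0 < r) :
    0 < phiSA n s A r :=
  mul_pos (by positivity) (hA.rcInv_pos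
    (by simpa using Real.rpow_pos_of_pos hr (-(n : ℝ))) ENNReal.ofReal_ne_top)

lemma exists_oscQuot_ge {n : ℕ} (hn : 0 < n) {s : ℝ} (hs : s ∈ Ioo (0 : ℝ) 1) {A : ℝ → ℝ≥0∞}
    (hA : IsYoung A) {φ : ℝ → ℝ} (hφ : Admissible φ) :
    ∃ c : ℝ, 0 < c ∧ ∀ r : ℝ, 0 < r → ∃ u : Euc n → ℝ, Measurable u ∧ fracSemS n s A u ≤ 1 ∧
      c * (phiSA n s A r / φ r) ≤ oscQuot n φ u 0 (r / unitBallSide n) := by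
  have hκ := unitBallSide_pos n
  have hb := bumpOsc_pos hn
  set I : ℝ≥0∞ := 2 * ∫⁻ h : Euc n, ENNReal.ofReal (bumpKernel n s ‖h‖) with hI
  have hItop : I ≠ ⊤ := ENNReal.mul_ne_top (by simp) (lintegral_bumpKernel_lt_top hn hs).ne
  have hI1 : 1 ≤ 1 + I.toReal := le_add_of_nonneg_right ENNReal.toReal_nonneg
  have hI0 : 0 < 1 + I.toReal := one_pos.trans_le hI1
  set θ : ℝ := (1 + I.toReal)⁻¹ with hθ
  have hθ0 : 0 < θ := by positivity
  have hθI : ENNReal.ofReal θ * I ≤ 1 := by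
    rw [← ENNReal.ofReal_toReal hItop, ← ENNReal.ofReal_mul hθ0.le, ← ENNReal.ofReal_one]
    apply ENNReal.ofReal_le_ofReal
    rw [hθ, inv_mul_le_iff₀ hI0]
    linarith
  refine ⟨θ * (unitBallSide n ^ s)⁻¹ * bumpOsc n, by positivity, fun r hr => ?_⟩
  set R := r / unitBallSide n with hRdef
  have hR : 0 < R := by positivity
  have hκR : unitBallSide n * R = r := mul_div_cancel₀ _ hκ.ne'
  set a := rcInv A (ENNReal.ofReal (r ^ (-(n : ℝ)))) with ha
  have ha0 : 0 ≤ a := Real.sInf_nonneg fun τ hτ => hτ.1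
  have hJ := Jfun_bump_le hn hs hA hR
  rw [hκR, ← ha, ← hI] at hJ
  have hφr : 0 < φ r := hφ.1 r hr
  refine ⟨fun x => θ * (R ^ s * a * bump n R x),
    ((continuous_bump n R).measurable.const_mul _).const_mul _, ?_, ?_⟩
  · refine sInf_le ⟨1, ⟨one_pos, ?_⟩, ENNReal.ofReal_one⟩
    simp only [div_one]
    exact ((Jfun_const_mul_le n s hA _ hθ0.le (inv_le_one_of_one_le₀ hI1)).trans
      (by gcongr)).trans hθI
  · rw [oscQuot_const_mul _ _ _ _ _ hθ0.le, oscQuot_const_mul _ _ _ _ _ (by positivity), oscQuot,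
      volume_ball_rpow_inv hn 0 hR, hκR]
    calc _ = θ * (R ^ s * a * ((φ r)⁻¹ * bumpOsc n)) := by
          rw [phiSA, ← ha, hRdef, Real.div_rpow hr.le hκ.le]
          simp only [div_eq_mul_inv]
          ring
      _ ≤ _ := by
          gcongr
          exact bumpOsc_le_setAverage hn hR _

/-- `V^{s,A}(ℝⁿ) → V𝓛^{φ}(ℝⁿ)` uniformly if and only if
`φ_{s,A} ≤ c φ` and `φ_{s,A}(r)/φ(r) → 0` as `r → 0⁺`. -/
theorem stmt2 (n : ℕ) (hn : 0 < n) (s : ℝ) (hs : s ∈ Set.Ioo (0 : ℝ) 1)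
    (A : ℝ → ℝ≥0∞) (hA : IsYoung A) (φ : ℝ → ℝ) (hφ : Admissible φ) :
    ((∃ c : ℝ, 0 < c ∧ ∀ u : Euc n → ℝ, Measurable u → fracSemS n s A u < ⊤ →
        campSem n φ u ≤ ENNReal.ofReal c * fracSemS n s A u) ∧
      Tendsto
        (fun r : ℝ => ⨆ (u : Euc n → ℝ) (_ : Measurable u) (_ : fracSemS n s A u ≤ 1),
          campSemSmall n φ u r)
        (𝓝[>] (0 : ℝ)) (𝓝 0)) ↔
    ((∃ c : ℝ, 0 < c ∧ ∀ r : ℝ, 0 < r → phiSA n s A r ≤ c * φ r) ∧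
      Tendsto (fun r : ℝ => phiSA n s A r / φ r) (𝓝[>] (0 : ℝ)) (𝓝 0)) := by
  have hκ := unitBallSide_pos n
  constructor
  · rintro ⟨⟨c, hc, hcamp⟩, hlim⟩
    obtain ⟨c₀, hc₀, htest⟩ := exists_oscQuot_ge hn hs hA hφ
    refine ⟨⟨c / c₀, by positivity, fun r hr => ?_⟩, ?_⟩
    · obtain ⟨u, hu, hu1, hosc⟩ := htest r hr
      have h1 : ENNReal.ofReal (c₀ * (phiSA n s A r / φ r)) ≤ ENNReal.ofReal c :=
        calc _ ≤ ENNReal.ofReal (oscQuot n φ u 0 (r / unitBallSide n)) :=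
              ENNReal.ofReal_le_ofReal hosc
          _ ≤ campSem n φ u :=
              le_iSup_of_le 0 (le_iSup_of_le _ (le_iSup_of_le (div_pos hr hκ) le_rfl))
          _ ≤ ENNReal.ofReal c * fracSemS n s A u :=
              hcamp u hu (hu1.trans_lt ENNReal.one_lt_top)
          _ ≤ ENNReal.ofReal c * 1 := by gcongr
          _ = _ := mul_one _
      have h2 := (ENNReal.ofReal_le_ofReal_iff hc.le).1 h1
      have hφr := hφ.1 r hr
      rw [mul_div_assoc', div_le_iff₀ hφr] at h2
      rw [div_mul_eq_mul_div, le_div_iff₀ hc₀, mul_comm]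
      exact h2
    · have hpow : Tendsto (fun r : ℝ => r ^ n) (𝓝[>] 0) (𝓝[>] 0) := by
        refine tendsto_nhdsWithin_iff.2 ⟨?_, ?_⟩
        · have : Tendsto (fun r : ℝ => r ^ n) (𝓝 0) (𝓝 (0 ^ n)) := (continuous_pow n).tendsto 0
          rw [zero_pow hn.ne'] at this
          exact this.mono_left nhdsWithin_le_nhds
        · filter_upwards [self_mem_nhdsWithin] with r hr using pow_pos (mem_Ioi.1 hr) n
      have hz : Tendsto (fun r => ENNReal.ofReal (c₀ * (phiSA n s A r / φ r))) (𝓝[>] 0)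
          (𝓝 0) := by
        refine tendsto_of_tendsto_of_tendsto_of_le_of_le' tendsto_const_nhds (hlim.comp hpow)
          (Eventually.of_forall fun _ => zero_le) ?_
        filter_upwards [self_mem_nhdsWithin] with r hr
        obtain ⟨u, hu, hu1, hosc⟩ := htest r hr
        have hR : 0 < r / unitBallSide n := div_pos hr hκ
        have hv : volume (ball (0 : Euc n) (r / unitBallSide n)) ≤ ENNReal.ofReal (r ^ n) := by
          rw [volume_ball_eq hn 0 hR, mul_div_cancel₀ _ hκ.ne', Real.rpow_natCast]
        refine (ENNReal.ofReal_le_ofReal hosc).trans ?_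
        exact le_iSup_of_le u (le_iSup_of_le hu (le_iSup_of_le hu1 (le_iSup_of_le 0
          (le_iSup_of_le _ (le_iSup_of_le hR (le_iSup_of_le hv le_rfl))))))
      have ht := ((ENNReal.tendsto_toReal ENNReal.zero_ne_top).comp hz).const_mul c₀⁻¹
      rw [ENNReal.toReal_zero, mul_zero] at ht
      refine ht.congr' ?_
      filter_upwards [self_mem_nhdsWithin] with r hr
      have h1 := phiSA_pos n s hA hr
      have h2 := hφ.1 r hr
      rw [Function.comp_apply, ENNReal.toReal_ofReal (by positivity), inv_mul_cancel_left₀ hc₀.ne']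
  · rintro ⟨⟨c, hc, hle⟩, hlim⟩
    have hC := oscConst_pos n s
    refine ⟨⟨oscConst n s * c, by positivity, fun u hu _ => ?_⟩, ?_⟩
    · refine le_ofReal_mul_fracSemS (by positivity) fun lam hl hJ => ?_
      refine iSup_le fun x => iSup_le fun ρ => iSup_le fun hρ => ENNReal.ofReal_le_ofReal ?_
      refine (oscQuot_le hn hs.1 hA hφ hu hl hJ x hρ).trans ?_
      gcongr
      rw [div_le_iff₀ (hφ.1 _ (by positivity))]
      exact hle _ (by positivity)
    · have hz : Tendsto (fun r => ENNReal.ofReal (oscConst n s * (phiSA n s A r / φ r))) (𝓝[>] 0)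
          (𝓝 0) := by
        have h := ENNReal.tendsto_ofReal (hlim.const_mul (oscConst n s))
        rwa [mul_zero, ENNReal.ofReal_zero] at h
      rw [ENNReal.tendsto_nhds_zero] at hz ⊢
      intro ε hε
      obtain ⟨δ, hδ, hδ'⟩ := mem_nhdsGT_iff_exists_Ioo_subset.1 (hz ε hε)
      have hδ0 : (0 : ℝ) < δ := hδ
      filter_upwards [Ioo_mem_nhdsGT (pow_pos hδ0 n)] with R hR
      refine iSup_le fun u => iSup_le fun hu => iSup_le fun hu1 => iSup_le fun x =>
        iSup_le fun ρ => iSup_le fun hρ => iSup_le fun hv => ?_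
      have hr : 0 < unitBallSide n * ρ := by positivity
      have hrδ : unitBallSide n * ρ < δ := by
        rw [volume_ball_eq hn x hρ, Real.rpow_natCast, ENNReal.ofReal_le_ofReal_iff hR.1.le] at hv
        exact lt_of_pow_lt_pow_left₀ n hδ0.le (hv.trans_lt hR.2)
      have hφr := hφ.1 _ hr
      have hphi := phiSA_pos n s hA hr
      refine le_trans ?_ (hδ' ⟨hr, hrδ⟩)
      refine (le_ofReal_mul_fracSemS (C := oscConst n s * (phiSA n s A (unitBallSide n * ρ) /
        φ (unitBallSide n * ρ))) (by positivity) fun lam hl hJ =>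
          ENNReal.ofReal_le_ofReal (oscQuot_le hn hs.1 hA hφ hu hl hJ x hρ)).trans ?_
      exact mul_le_of_le_one_right zero_le hu1
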